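/- arXiv:1605.08518 — 12 statements merged into one kernel-verified Lean document; each statement's English description precedes it below -/
import Mathlib

section
/- Let B, N0, β, C, P, h > 0, set v = B·C·P·h²/(N0·ln 2), and suppose v ≥ 1. Define x = (β·N0/h²)·(v·ln v − v + 1) and X = B·log₂(v). Then, with f(x) = N0·(2^{x/B} − 1), f'(x) = (N0·ln 2/B)·2^{x/B}, and g(x) = f(x) − x·f'(x), one has f'(X) = C·P·h² and g(X) = −h²·x/β. In other words, x is a root of the equation f'^{-1}(C·P·h²) = g^{-1}(−h²·x/β). -/
/-- The offloading priority `x = (β·N0/h²)·(v·ln v − v + 1)` with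
`v = B·C·P·h²/(N0·ln 2) ≥ 1` is a root of
`f'^{-1}(C·P·h²) = g^{-1}(−h²·x/β)`: the point `X = B·log₂ v` satisfies
`f'(X) = C·P·h²` and `g(X) = −h²·x/β`. -/
theorem offloading_priority_root (B N0 β C P h : ℝ)
    (hB : 0 < B) (hN0 : 0 < N0) (hβ : 0 < β) (hC : 0 < C) (hP : 0 < P) (hh : 0 < h)
    (v : ℝ) (hv : v = B * C * P * h ^ 2 / (N0 * Real.log 2)) (hv1 : 1 ≤ v)
    (x : ℝ) (hx : x = (β * N0 / h ^ 2) * (v * Real.log v - v + 1))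
    (X : ℝ) (hX : X = B * Real.logb 2 v)
    (f f' g : ℝ → ℝ)
    (hf : ∀ y, f y = N0 * ((2 : ℝ) ^ (y / B) - 1))
    (hf' : ∀ y, f' y = N0 * Real.log 2 / B * (2 : ℝ) ^ (y / B))
    (hg : ∀ y, g y = f y - y * f' y) :
    f' X = C * P * h ^ 2 ∧ g X = -(h ^ 2) * x / β := by
  have hlog : 0 < Real.log 2 := Real.log_pos one_lt_two
  have hpow : (2 : ℝ) ^ (X / B) = v := by
    rw [hX, mul_div_cancel_left₀ _ hB.ne']
    exact Real.rpow_logb two_pos (by norm_num) (by linarith)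
  constructor
  · rw [hf', hpow, hv]
    field_simp
  · rw [hg, hf, hf', hpow, hX, hx, Real.logb]
    field_simp
    ring
end

section
/- Let B, N0 > 0 be fixed and define, for β, C, P, h > 0, v(β,C,P,h) = B·C·P·h²/(N0·ln 2) and φ(β,C,P,h) = (β·N0/h²)·(v·ln v − v + 1) when v ≥ 1. Then on the region {(β,C,P,h) : v(β,C,P,h) ≥ 1}, φ is monotone nondecreasing in each of its four arguments separately; that is, if β ≤ β', C ≤ C', P ≤ P', h ≤ h' and both v(β,C,P,h) ≥ 1 and v(β',C',P',h') ≥ 1, then φ(β,C,P,h) ≤ φ(β',C',P',h'). -/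
/-- `x ↦ log x - 1 + 1 / x` is nondecreasing on `[1, ∞)`. -/
theorem log_sub_one_add_inv_monotoneOn :
    MonotoneOn (fun x : ℝ => Real.log x - 1 + x⁻¹) (Set.Ici 1) := by
  intro x hx y hy hxy
  have hx1 : (1 : ℝ) ≤ x := hx
  have hx0 : 0 < x := by linarith
  have hy0 : 0 < y := by linarith
  have hlog := Real.one_sub_inv_le_log_of_pos (div_pos hy0 hx0)
  rw [Real.log_div hy0.ne' hx0.ne', inv_div] at hlog
  have key : x⁻¹ - y⁻¹ ≤ 1 - x / y := by
    have e : 1 - x / y - (x⁻¹ - y⁻¹) = (y - x) * (x - 1) / (x * y) := by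
      field_simp
    have : 0 ≤ (y - x) * (x - 1) / (x * y) :=
      div_nonneg (mul_nonneg (by linarith) (by linarith)) (by positivity)
    linarith
  show Real.log x - 1 + x⁻¹ ≤ Real.log y - 1 + y⁻¹
  linarith

/-- Monotonicity of the offloading priority function: on the region where
`v(β,C,P,h) = B·C·P·h²/(N0·ln 2) ≥ 1`,
`φ(β,C,P,h) = (β·N0/h²)·(v·ln v − v + 1)` is nondecreasing in each argument. -/
theorem offloading_priority_monotone (B N0 : ℝ) (hB : 0 < B) (hN0 : 0 < N0)
    (v φ : ℝ → ℝ → ℝ → ℝ → ℝ)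
    (hv : ∀ β C P h, v β C P h = B * C * P * h ^ 2 / (N0 * Real.log 2))
    (hφ : ∀ β C P h, φ β C P h =
      (β * N0 / h ^ 2) * (v β C P h * Real.log (v β C P h) - v β C P h + 1))
    (β β' C C' P P' h h' : ℝ)
    (hβ : 0 < β) (hC : 0 < C) (hP : 0 < P) (hh : 0 < h)
    (hβ' : 0 < β') (hC' : 0 < C') (hP' : 0 < P') (hh' : 0 < h')
    (h1 : β ≤ β') (h2 : C ≤ C') (h3 : P ≤ P') (h4 : h ≤ h')
    (hv1 : 1 ≤ v β C P h) (hv2 : 1 ≤ v β' C' P' h') :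
    φ β C P h ≤ φ β' C' P' h' := by
  have hlog2 : 0 < Real.log 2 := Real.log_pos one_lt_two
  have factor : ∀ b c p t : ℝ, 0 < t → 1 ≤ v b c p t →
      φ b c p t = b * N0 * (B * c * p / (N0 * Real.log 2)) *
        (Real.log (v b c p t) - 1 + (v b c p t)⁻¹) := by
    intro b c p t ht hvt
    have hv0 : v b c p t ≠ 0 := by linarith
    have hk : B * c * p / (N0 * Real.log 2) = v b c p t / t ^ 2 := by
      rw [hv]
      field_simp
    rw [hφ, hk]
    field_simp
  have hvv : v β C P h ≤ v β' C' P' h' := by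
    rw [hv, hv]
    gcongr
  have hmono := log_sub_one_add_inv_monotoneOn hv1 hv2 hvv
  have hnonneg : 0 ≤ Real.log (v β C P h) - 1 + (v β C P h)⁻¹ := by
    simpa using log_sub_one_add_inv_monotoneOn Set.self_mem_Ici hv1 hv1
  rw [factor β C P h hh hv1, factor β' C' P' h' hh' hv2]
  have hcoef : β * N0 * (B * C * P / (N0 * Real.log 2)) ≤
      β' * N0 * (B * C' * P' / (N0 * Real.log 2)) := by
    gcongr
  exact mul_le_mul hcoef hmono hnonneg (by positivity)
end

section
/- Let B, N0, C, P, h > 0 and suppose B·C·P·h² ≤ N0·ln 2 (i.e., v = B·C·P·h²/(N0·ln 2) ≤ 1). Then for every t > 0 and every ℓ ≥ 0, the offloading energy is at least the local computing energy: (t/h²)·N0·(2^{ℓ/(B·t)} − 1) ≥ ℓ·C·P. -/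
/-- When `v = B·C·P·h²/(N0·ln 2) ≤ 1`, offloading never saves energy: for every
`t > 0` and `ℓ ≥ 0`, the offloading energy `(t/h²)·N0·(2^{ℓ/(B·t)} − 1)` is at
least the local computing energy `ℓ·C·P`. -/
theorem offloading_never_saves_energy (B N0 C P h : ℝ)
    (hB : 0 < B) (hN0 : 0 < N0) (hC : 0 < C) (hP : 0 < P) (hh : 0 < h)
    (hcond : B * C * P * h ^ 2 ≤ N0 * Real.log 2) :
    ∀ t ℓ : ℝ, 0 < t → 0 ≤ ℓ →
      ℓ * C * P ≤ (t / h ^ 2) * (N0 * ((2 : ℝ) ^ (ℓ / (B * t)) - 1)) := by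
  intro t ℓ ht hℓ
  have two_rpow_bound : Real.log 2 * (ℓ / (B * t)) ≤ (2 : ℝ) ^ (ℓ / (B * t)) - 1 := by
    rw [Real.rpow_def_of_pos two_pos]
    linarith [Real.add_one_le_exp (Real.log 2 * (ℓ / (B * t)))]
  calc
    ℓ * C * P = ℓ / (B * h ^ 2) * (B * C * P * h ^ 2) := by field_simp
    _ ≤ ℓ / (B * h ^ 2) * (N0 * Real.log 2) := by gcongr
    _ = t / h ^ 2 * (N0 * (Real.log 2 * (ℓ / (B * t)))) := by field_simp
    _ ≤ t / h ^ 2 * (N0 * ((2 : ℝ) ^ (ℓ / (B * t)) - 1)) := by gcongr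
end

section
/- Let B, N0, C, P, h > 0 and suppose B·C·P·h² > N0·ln 2 (i.e., v = B·C·P·h²/(N0·ln 2) > 1). Then there exist ℓ > 0 and t > 0 such that the offloading energy is strictly less than the local computing energy: (t/h²)·N0·(2^{ℓ/(B·t)} − 1) < ℓ·C·P. -/
/-- A slope bound exceeding `log 2` dominates `2 ^ x - 1` for some positive `x`. -/
lemma exists_pos_two_rpow_sub_one_lt_mul {K : ℝ} (hK : Real.log 2 < K) :
    ∃ x : ℝ, 0 < x ∧ (2 : ℝ) ^ x - 1 < K * x := by
  have hderiv : HasDerivAt (fun x : ℝ => (2 : ℝ) ^ x) (Real.log 2) 0 := by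
    simpa using (hasDerivAt_id (0 : ℝ)).const_rpow (two_pos : (0 : ℝ) < 2)
  obtain ⟨x, hx, hx0⟩ :=
    ((hderiv.tendsto_slope_zero_right.eventually_lt_const hK).and
      self_mem_nhdsWithin).exists
  have hx0 : 0 < x := hx0
  refine ⟨x, hx0, ?_⟩
  rw [zero_add, Real.rpow_zero, smul_eq_mul, inv_mul_eq_div, div_lt_iff₀ hx0] at hx
  exact hx

/-- When `v = B·C·P·h²/(N0·ln 2) > 1`, offloading can save energy: there exist
`ℓ > 0` and `t > 0` such that the offloading energy
`(t/h²)·N0·(2^{ℓ/(B·t)} − 1)` is strictly less than the local computing energy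
`ℓ·C·P`. -/
theorem offloading_can_save_energy (B N0 C P h : ℝ)
    (hB : 0 < B) (hN0 : 0 < N0) (hC : 0 < C) (hP : 0 < P) (hh : 0 < h)
    (hcond : N0 * Real.log 2 < B * C * P * h ^ 2) :
    ∃ ℓ t : ℝ, 0 < ℓ ∧ 0 < t ∧
      (t / h ^ 2) * (N0 * ((2 : ℝ) ^ (ℓ / (B * t)) - 1)) < ℓ * C * P := by
  obtain ⟨x, hx, hlt⟩ :=
    exists_pos_two_rpow_sub_one_lt_mul (K := B * C * P * h ^ 2 / N0)
      ((lt_div_iff₀' hN0).mpr hcond)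
  refine ⟨B * x, 1, mul_pos hB hx, one_pos, ?_⟩
  rw [mul_one, mul_div_cancel_left₀ x hB.ne', div_mul_eq_mul_div, one_mul,
    div_lt_iff₀ (by positivity)]
  calc N0 * ((2 : ℝ) ^ x - 1) < N0 * (B * C * P * h ^ 2 / N0 * x) := by gcongr
    _ = B * x * C * P * h ^ 2 := by field_simp
end

section
/- In the setting of the TDMA MECO Problem P2 with K users (parameters B, N0, T > 0; β_k, C_k, P_k, h_k > 0; R_k ≥ 0; F_k ≥ 0; feasible set D; energy E as defined), assume m_k = R_k − F_k·T/C_k ≤ 0 for all k, let φ_k be the offloading priority of user k, let m be an index with v_m = B·C_m·P_m·h_m²/(N0·ln 2) > 1 and φ_m > φ_k for all k ≠ m, and suppose T ≤ R_m / (B·log₂(B·C_m·P_m·h_m²/(N0·ln 2))). Then there exists a minimizer (ℓ*, t*) of E over D such that ℓ*_k = 0 and t*_k = 0 for every k ≠ m; i.e., only mobile m offloads computation. -/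
/-- The minimum of `exp y - 1 - v * y` over `y ≥ 0` is attained at `y = log v` when `1 ≤ v`,
and at `y = 0` otherwise. -/
lemma neg_ite_le_exp_sub_one_sub_mul {v y : ℝ} (hy : 0 ≤ y) :
    -(if 1 ≤ v then v * Real.log v - v + 1 else 0) ≤ Real.exp y - 1 - v * y := by
  split_ifs with hv
  · have hv0 : 0 < v := by linarith
    have h1 := mul_le_mul_of_nonneg_left (Real.add_one_le_exp (y - Real.log v)) hv0.le
    rw [Real.exp_sub, Real.exp_log hv0, mul_div_cancel₀ _ hv0.ne'] at h1
    linarith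
  · nlinarith [Real.add_one_le_exp y]

lemma mul_log_sub_add_one_nonneg {v : ℝ} (hv : 0 < v) : 0 ≤ v * Real.log v - v + 1 := by
  have h1 := mul_le_mul_of_nonneg_left (Real.one_sub_inv_le_log_of_pos hv) hv.le
  rw [mul_sub, mul_inv_cancel₀ hv.ne'] at h1
  linarith

/-- The change in weighted energy caused by offloading `ℓ` bits in time `t`, in the
normalized variable `y = ℓ * log 2 / (t * B)`. -/
lemma weighted_offloading_energy_eq {B N0 β C P h t ℓ : ℝ} (hB : 0 < B) (hN0 : 0 < N0)
    (hh : 0 < h) (ht : 0 < t) :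
    β * (t / h ^ 2 * (N0 * ((2 : ℝ) ^ (ℓ / t / B) - 1)) - ℓ * C * P) =
      t * (β * N0 / h ^ 2) * (Real.exp (ℓ / t / B * Real.log 2) - 1 -
        B * C * P * h ^ 2 / (N0 * Real.log 2) * (ℓ / t / B * Real.log 2)) := by
  have hlog : 0 < Real.log 2 := Real.log_pos one_lt_two
  rw [Real.rpow_def_of_pos two_pos, mul_comm (Real.log 2)]
  generalize Real.exp (ℓ / t / B * Real.log 2) = e
  field_simp

/-- Offloading for a time `t` lowers the weighted energy by at most `t` times the offloading
priority. -/
lemma neg_mul_priority_le {B N0 β C P h t ℓ : ℝ} (hB : 0 < B) (hN0 : 0 < N0) (hβ : 0 < β)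
    (hh : 0 < h) (ht : 0 ≤ t) (hℓ : 0 ≤ ℓ) (hℓt : 0 < ℓ → 0 < t) {v : ℝ}
    (hv : v = B * C * P * h ^ 2 / (N0 * Real.log 2)) :
    -(t * (if 1 ≤ v then β * N0 / h ^ 2 * (v * Real.log v - v + 1) else 0)) ≤
      β * (t / h ^ 2 * (N0 * ((2 : ℝ) ^ (ℓ / t / B) - 1)) - ℓ * C * P) := by
  rcases ht.eq_or_lt with rfl | ht
  · have h0 : ℓ = 0 := le_antisymm (not_lt.1 fun h => lt_irrefl _ (hℓt h)) hℓ
    simp [h0]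
  · rw [weighted_offloading_energy_eq hB hN0 hh ht, ← hv]
    have hlog : 0 < Real.log 2 := Real.log_pos one_lt_two
    have key := neg_ite_le_exp_sub_one_sub_mul (v := v)
      (show 0 ≤ ℓ / t / B * Real.log 2 by positivity)
    refine le_trans (le_of_eq ?_)
      (mul_le_mul_of_nonneg_left key (show 0 ≤ t * (β * N0 / h ^ 2) by positivity))
    split_ifs <;> ring


/-- Proposition 1 (Exclusive Mobile Computation Offloading): in the setting of
Problem P2, if `m_k ≤ 0` for all `k`, user `m` has `v_m > 1` and strictly the
highest offloading priority, and the slot duration satisfies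
`T ≤ R_m / (B·log₂(B·C_m·P_m·h_m²/(N0·ln 2)))`, then there is a minimizer for
which only mobile `m` offloads computation. -/
theorem exclusive_mobile_computation_offloading (K : ℕ) (B N0 T : ℝ)
    (hB : 0 < B) (hN0 : 0 < N0) (hT : 0 < T)
    (β C P h R Floc : Fin K → ℝ)
    (hβ : ∀ k, 0 < β k) (hC : ∀ k, 0 < C k) (hP : ∀ k, 0 < P k) (hh : ∀ k, 0 < h k)
    (hR : ∀ k, 0 ≤ R k) (hFloc : ∀ k, 0 ≤ Floc k)
    (f : ℝ → ℝ)
    (hf : ∀ x, f x = N0 * ((2 : ℝ) ^ (x / B) - 1))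
    (mplus : Fin K → ℝ) (hm : ∀ k, mplus k = max (R k - Floc k * T / C k) 0)
    (v : Fin K → ℝ) (hv : ∀ k, v k = B * C k * P k * (h k) ^ 2 / (N0 * Real.log 2))
    (φ : Fin K → ℝ)
    (hφ : ∀ k, φ k = if 1 ≤ v k then
      (β k * N0 / (h k) ^ 2) * (v k * Real.log (v k) - v k + 1) else 0)
    (E : (Fin K → ℝ) → (Fin K → ℝ) → ℝ)
    (hE : ∀ ℓ t, E ℓ t =
      ∑ k, β k * ((t k / (h k) ^ 2) * f (ℓ k / t k) + (R k - ℓ k) * C k * P k))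
    (D : (Fin K → ℝ) → (Fin K → ℝ) → Prop)
    (hD : ∀ ℓ t, D ℓ t ↔
      ((∑ k, t k) ≤ T ∧ (∀ k, 0 ≤ t k) ∧
       (∀ k, mplus k ≤ ℓ k ∧ ℓ k ≤ R k) ∧ (∀ k, 0 < ℓ k → 0 < t k)))
    (hmk : ∀ k, R k - Floc k * T / C k ≤ 0)
    (m : Fin K) (hvm : 1 < v m)
    (hφm : ∀ k, k ≠ m → φ k < φ m)
    (hTshort : T ≤ R m /
      (B * Real.logb 2 (B * C m * P m * (h m) ^ 2 / (N0 * Real.log 2)))) :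
    ∃ ℓs ts : Fin K → ℝ, D ℓs ts ∧ (∀ ℓ t, D ℓ t → E ℓs ts ≤ E ℓ t) ∧
      ∀ k, k ≠ m → ℓs k = 0 ∧ ts k = 0 := by
  have hlog : 0 < Real.log 2 := Real.log_pos one_lt_two
  have hmplus : ∀ k, mplus k = 0 := fun k => by rw [hm, max_eq_right (hmk k)]
  have hvm0 : 0 < v m := by linarith
  have hlogb : 0 < Real.logb 2 (v m) := Real.logb_pos one_lt_two hvm
  have hφm_eq : φ m = β m * N0 / (h m) ^ 2 * (v m * Real.log (v m) - v m + 1) := by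
    rw [hφ, if_pos hvm.le]
  have hφm0 : 0 ≤ φ m := by
    rw [hφm_eq]
    have := hβ m
    have := hh m
    exact mul_nonneg (by positivity) (mul_log_sub_add_one_nonneg hvm0)
  have hE' : ∀ ℓ t, E ℓ t = (∑ k, β k * (R k * C k * P k)) +
      ∑ k, β k * (t k / (h k) ^ 2 * (N0 * ((2 : ℝ) ^ (ℓ k / t k / B) - 1)) -
        ℓ k * C k * P k) := fun ℓ t => by
    rw [hE, ← Finset.sum_add_distrib]
    refine Finset.sum_congr rfl fun k _ => ?_
    rw [hf]
    ring
  have hlower : ∀ ℓ t, D ℓ t → (∑ k, β k * (R k * C k * P k)) - T * φ m ≤ E ℓ t := by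
    intro ℓ t hℓt
    obtain ⟨hsum, ht, hℓ, hpos⟩ := (hD ℓ t).1 hℓt
    have hterm : ∀ k, -(t k * φ m) ≤
        β k * (t k / (h k) ^ 2 * (N0 * ((2 : ℝ) ^ (ℓ k / t k / B) - 1)) -
          ℓ k * C k * P k) := fun k => by
      have hle : φ k ≤ φ m := by
        rcases eq_or_ne k m with rfl | hk
        · exact le_rfl
        · exact (hφm k hk).le
      have hsave := neg_mul_priority_le hB hN0 (hβ k) (hh k) (ht k)
        (hmplus k ▸ (hℓ k).1) (hpos k) (hv k)
      rw [← hφ k] at hsave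
      exact (neg_le_neg (mul_le_mul_of_nonneg_left hle (ht k))).trans hsave
    have hsums := Finset.sum_le_sum fun k (_ : k ∈ Finset.univ) => hterm k
    rw [Finset.sum_neg_distrib, ← Finset.sum_mul] at hsums
    rw [hE']
    linarith [mul_le_mul_of_nonneg_right hsum hφm0]
  refine ⟨Pi.single m (T * (B * Real.logb 2 (v m))), Pi.single m T, ?_, fun ℓ t hℓt => ?_,
    fun k hk => by simp [hk]⟩
  · refine (hD _ _).2 ⟨by simp, fun k => ?_, fun k => ?_, fun k => ?_⟩
    all_goals rcases eq_or_ne k m with rfl | hk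
    · simpa using hT.le
    · simp [hk]
    · rw [hmplus, Pi.single_eq_same]
      refine ⟨by positivity, ?_⟩
      rwa [← hv, le_div_iff₀ (by positivity)] at hTshort
    · simpa [hk, hmplus] using hR k
    · simpa using fun _ => hT
    · simp [hk]
  · refine le_trans (le_of_eq ?_) (hlower ℓ t hℓt)
    rw [hE', sub_eq_add_neg]
    congr 1
    rw [Finset.sum_eq_single m (fun k _ hk => by simp [hk]) (by simp), Pi.single_eq_same,
      Pi.single_eq_same, weighted_offloading_energy_eq hB hN0 (hh m) hT, ← hv, hφm_eq]
    have hy : T * (B * Real.logb 2 (v m)) / T / B * Real.log 2 = Real.log (v m) := by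
      rw [Real.logb]
      field_simp
    rw [hy, Real.exp_log hvm0]
    ring
end

section
/- In the setting of the TDMA MECO Problem P2 with K users (parameters B, N0, T > 0; β_k, C_k, P_k, h_k > 0; R_k ≥ 0; F_k ≥ 0; feasible set D; energy E as defined), let O₁ = {k : φ_k > 0} and O₂ = {k : φ_k = 0}, assume O₁ is nonempty, and let λ_min = min_{k ∈ O₁} φ_k. For each k, let r_k > 0 be the unique positive real satisfying g(r_k) = −h_k²·λ_min/β_k. If T ≥ Σ_{k ∈ O₁} R_k/r_k + Σ_{k ∈ O₂} m_k⁺/r_k, then there exists a minimizer (ℓ*, t*) of E over D with ℓ*_k = R_k for every k ∈ O₁; i.e., all offloading-desired mobiles completely offload their computation. -/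
/-- In the normalized rate `u = r · log 2 / B`, the negated reduced power `-g(r) / N0`. -/
noncomputable def reducedPower (u : ℝ) : ℝ := Real.exp u * (u - 1) + 1

theorem reducedPower_zero : reducedPower 0 = 0 := by
  simp [reducedPower]

theorem continuous_reducedPower : Continuous reducedPower := by
  unfold reducedPower
  fun_prop

theorem strictMonoOn_reducedPower : StrictMonoOn reducedPower (Set.Ici 0) := by
  apply strictMonoOn_of_deriv_pos (convex_Ici 0) continuous_reducedPower.continuousOn
  intro x hx
  rw [interior_Ici, Set.mem_Ioi] at hx
  have hd : HasDerivAt reducedPower (Real.exp x * (x - 1) + Real.exp x * 1) x :=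
    ((Real.hasDerivAt_exp x).mul ((hasDerivAt_id x).sub_const 1)).add_const 1
  rw [hd.deriv]
  have := mul_pos (Real.exp_pos x) hx
  linarith

theorem reducedPower_nonneg {u : ℝ} (hu : 0 ≤ u) : 0 ≤ reducedPower u := by
  rw [← reducedPower_zero]
  exact strictMonoOn_reducedPower.monotoneOn Set.self_mem_Ici hu hu

theorem le_reducedPower {u : ℝ} (hu : 2 ≤ u) : u ≤ reducedPower u := by
  unfold reducedPower
  nlinarith [Real.add_one_le_exp u]

/-- `reducedPower` has a continuous strictly monotone inverse on the nonnegative reals. -/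
theorem exists_inverse_reducedPower :
    ∃ W : ℝ → ℝ, Continuous W ∧ StrictMono W ∧ W 0 = 0 ∧
      (∀ y, 0 ≤ y → reducedPower (W y) = y) ∧ ∀ u, 0 ≤ u → W (reducedPower u) = u := by
  let q : ℝ → ℝ := fun u => reducedPower (max u 0) + min u 0
  have hq : Continuous q :=
    (continuous_reducedPower.comp (continuous_id.max continuous_const)).add
      (continuous_id.min continuous_const)
  have q_nonneg : ∀ u, 0 ≤ u → q u = reducedPower u := fun u hu => by simp [q, hu]
  have q_nonpos : ∀ u, u ≤ 0 → q u = u := fun u hu => by simp [q, hu, reducedPower_zero]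
  have hmono : StrictMono q := by
    intro a b hab
    rcases le_or_gt 0 a with ha | ha
    · rw [q_nonneg a ha, q_nonneg b (ha.trans hab.le)]
      exact strictMonoOn_reducedPower ha (ha.trans hab.le) hab
    · rw [q_nonpos a ha.le]
      rcases le_or_gt b 0 with hb | hb
      · rwa [q_nonpos b hb]
      · rw [q_nonneg b hb.le]
        exact ha.trans_le (reducedPower_nonneg hb.le)
  have hsurj : Function.Surjective q := by
    apply hq.surjective
    · refine Filter.tendsto_atTop_mono' _ ?_ Filter.tendsto_id
      filter_upwards [Filter.eventually_ge_atTop 2] with u hu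
      rw [q_nonneg u (by linarith)]
      exact le_reducedPower hu
    · refine Filter.tendsto_atBot_mono' _ ?_ Filter.tendsto_id
      filter_upwards [Filter.eventually_le_atBot 0] with u hu
      exact (q_nonpos u hu).le
  let e : ℝ ≃o ℝ := hmono.orderIsoOfSurjective q hsurj
  have he : ∀ u, e u = q u := fun _ => rfl
  have hinv : ∀ u, 0 ≤ u → e.symm (reducedPower u) = u := fun u hu => by
    rw [← q_nonneg u hu, ← he, e.symm_apply_apply]
  have h0 : e.symm 0 = 0 := by
    have := hinv 0 le_rfl
    rwa [reducedPower_zero] at this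
  refine ⟨e.symm, e.symm.continuous, e.symm.strictMono, h0, fun y hy => ?_, hinv⟩
  have hy' : 0 ≤ e.symm y := h0 ▸ e.symm.monotone hy
  rw [← q_nonneg _ hy', ← he, e.apply_symm_apply]

/-- If transmitting the loads `ℓ` at the rates of priority level `lam₀` fits in the slot, then some
level `lam ≤ lam₀` satisfies feasibility and complementary slackness. -/
theorem exists_priority_level {ι : Type*} [Fintype ι] {c T lam₀ : ℝ} {a ℓ ρ : ι → ℝ}
    (hc : 0 < c) (hT : 0 < T) (hlam₀ : 0 < lam₀) (ha : ∀ k, 0 < a k) (hℓ : ∀ k, 0 ≤ ℓ k)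
    (hρ : ∀ k, 0 ≤ ρ k) (hρlam : ∀ k, reducedPower (ρ k) = a k * lam₀)
    (hfit : ∑ k, ℓ k / (c * ρ k) ≤ T) :
    ∃ (lam : ℝ) (u t : ι → ℝ), 0 ≤ lam ∧ lam ≤ lam₀ ∧ (∀ k, 0 ≤ u k) ∧
      (∀ k, reducedPower (u k) = a k * lam) ∧ (∀ k, 0 ≤ t k) ∧ ∑ k, t k ≤ T ∧
      lam * (T - ∑ k, t k) = 0 ∧ ∀ k, t k * (c * u k) = ℓ k := by
  obtain ⟨W, hWc, hWm, hW0, hW, hWinv⟩ := exists_inverse_reducedPower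
  by_cases hzero : ∀ k, ℓ k = 0
  · refine ⟨0, 0, 0, le_rfl, hlam₀.le, ?_⟩
    simp [reducedPower_zero, hzero, hT.le]
  push Not at hzero
  obtain ⟨j, hj⟩ := hzero
  have hj : 0 < ℓ j := lt_of_le_of_ne (hℓ j) (Ne.symm hj)
  have hWpos : ∀ y, 0 < y → 0 < W y := fun y hy => hW0 ▸ hWm hy
  let S : ℝ → ℝ := fun lam => ∑ k, ℓ k / (c * W (a k * lam))
  have hden : ∀ lam, 0 < lam → ∀ k, 0 < c * W (a k * lam) := fun lam hlam k =>
    mul_pos hc (hWpos _ (mul_pos (ha k) hlam))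
  have hS₀ : S lam₀ ≤ T := by
    refine le_of_eq_of_le (Finset.sum_congr rfl fun k _ => ?_) hfit
    rw [← hρlam k, hWinv _ (hρ k)]
  let x : ℝ := ℓ j / (T * c)
  have hx : 0 < x := by positivity
  let lam₁ : ℝ := reducedPower x / a j
  have hlam₁ : 0 < lam₁ := by
    refine div_pos ?_ (ha j)
    have := strictMonoOn_reducedPower Set.self_mem_Ici hx.le hx
    rwa [reducedPower_zero] at this
  have hS₁ : T ≤ S lam₁ := by
    have hle : ℓ j / (c * W (a j * lam₁)) ≤ S lam₁ :=
      Finset.single_le_sum (f := fun k => ℓ k / (c * W (a k * lam₁)))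
        (fun k _ => div_nonneg (hℓ k) (hden _ hlam₁ k).le) (Finset.mem_univ j)
    have haj : a j * lam₁ = reducedPower x := mul_div_cancel₀ _ (ha j).ne'
    have hTj : ℓ j / (c * W (a j * lam₁)) = T := by
      rw [haj, hWinv x hx.le]
      simp only [x]
      field_simp
    linarith
  have hlevel : ∃ lam, 0 < lam ∧ lam ≤ lam₀ ∧ S lam = T := by
    rcases le_total lam₀ lam₁ with hle | hle
    · refine ⟨lam₀, hlam₀, le_rfl, le_antisymm hS₀ (hS₁.trans ?_)⟩
      refine Finset.sum_le_sum fun k _ => ?_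
      refine div_le_div_of_nonneg_left (hℓ k) (hden _ hlam₀ k) ?_
      exact mul_le_mul_of_nonneg_left
        (hWm.monotone (mul_le_mul_of_nonneg_left hle (ha k).le)) hc.le
    · have hcont : ContinuousOn S (Set.Icc lam₁ lam₀) := by
        refine continuousOn_finsetSum _ fun k _ => ?_
        refine ContinuousOn.div continuousOn_const ?_ ?_
        · exact (continuous_const.mul (hWc.comp (continuous_const.mul continuous_id))).continuousOn
        · exact fun y hy => (hden y (hlam₁.trans_le hy.1) k).ne'
      obtain ⟨lam, hlam, hSlam⟩ := intermediate_value_Icc' hle hcont ⟨hS₀, hS₁⟩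
      exact ⟨lam, hlam₁.trans_le hlam.1, hlam.2, hSlam⟩
  obtain ⟨lam, hlam, hlamle, hSlam⟩ := hlevel
  refine ⟨lam, fun k => W (a k * lam), fun k => ℓ k / (c * W (a k * lam)), hlam.le, hlamle,
    fun k => (hWpos _ (mul_pos (ha k) hlam)).le, fun k => hW _ (mul_pos (ha k) hlam).le,
    fun k => div_nonneg (hℓ k) (hden _ hlam k).le, hSlam.le, ?_,
    fun k => div_mul_cancel₀ _ (hden _ hlam k).ne'⟩
  change lam * (T - S lam) = 0
  rw [hSlam, sub_self, mul_zero]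

/-- Tangent-plane bound for the perspective of the exponential transmission power. -/
theorem tangent_le_perspective {c u ℓ t : ℝ} (hℓ : 0 ≤ ℓ) (ht : 0 ≤ t)
    (hpos : 0 < ℓ → 0 < t) :
    Real.exp u * (ℓ / c) - reducedPower u * t ≤ t * (Real.exp (ℓ / t / c) - 1) := by
  rcases ht.eq_or_lt with rfl | ht
  · have : ℓ = 0 := le_antisymm (not_lt.mp fun h => lt_irrefl _ (hpos h)) hℓ
    simp [this]
  have hexp : Real.exp u * (ℓ / t / c - u + 1) ≤ Real.exp (ℓ / t / c) := by
    have := mul_le_mul_of_nonneg_left (Real.add_one_le_exp (ℓ / t / c - u)) (Real.exp_pos u).le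
    rwa [← Real.exp_add, add_sub_cancel] at this
  have hmul := mul_le_mul_of_nonneg_left hexp ht.le
  have hts : t * (ℓ / t / c) = ℓ / c := by field_simp
  unfold reducedPower
  linear_combination hmul - Real.exp u * hts

/-- The tangent-plane bound is attained when the load is sent at normalized rate `u`. -/
theorem tangent_eq_perspective {c u ℓ t : ℝ} (hc : 0 < c) (hℓ : t * (c * u) = ℓ) :
    t * (Real.exp (ℓ / t / c) - 1) = Real.exp u * (ℓ / c) - reducedPower u * t := by
  subst hℓ
  rcases eq_or_ne t 0 with rfl | ht
  · simp
  have h1 : t * (c * u) / t / c = u := by field_simp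
  have h2 : t * (c * u) / c = t * u := by field_simp
  rw [h1, h2, reducedPower]
  ring


/-- Proposition 2 (Inclusive Mobile Computation Offloading): in the setting of
Problem P2, let `O₁ = {k : φ_k > 0}`, `O₂ = {k : φ_k = 0}`,
`λ_min = min_{k ∈ O₁} φ_k`, and let `r_k > 0` satisfy
`g(r_k) = −h_k²·λ_min/β_k`. If `T ≥ Σ_{k ∈ O₁} R_k/r_k + Σ_{k ∈ O₂} m_k⁺/r_k`,
then there is a minimizer for which every offloading-desired mobile completely
offloads its computation. -/
theorem inclusive_mobile_computation_offloading (K : ℕ) (B N0 T : ℝ)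
    (hB : 0 < B) (hN0 : 0 < N0) (hT : 0 < T)
    (β C P h R Floc : Fin K → ℝ)
    (hβ : ∀ k, 0 < β k) (hC : ∀ k, 0 < C k) (hP : ∀ k, 0 < P k) (hh : ∀ k, 0 < h k)
    (hR : ∀ k, 0 ≤ R k) (hFloc : ∀ k, 0 ≤ Floc k)
    (f g : ℝ → ℝ)
    (hf : ∀ x, f x = N0 * ((2 : ℝ) ^ (x / B) - 1))
    (hg : ∀ x, g x = f x - x * (N0 * Real.log 2 / B * (2 : ℝ) ^ (x / B)))
    (mplus : Fin K → ℝ) (hm : ∀ k, mplus k = max (R k - Floc k * T / C k) 0)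
    (v : Fin K → ℝ) (hv : ∀ k, v k = B * C k * P k * (h k) ^ 2 / (N0 * Real.log 2))
    (φ : Fin K → ℝ)
    (hφ : ∀ k, φ k = if 1 ≤ v k then
      (β k * N0 / (h k) ^ 2) * (v k * Real.log (v k) - v k + 1) else 0)
    (E : (Fin K → ℝ) → (Fin K → ℝ) → ℝ)
    (hE : ∀ ℓ t, E ℓ t =
      ∑ k, β k * ((t k / (h k) ^ 2) * f (ℓ k / t k) + (R k - ℓ k) * C k * P k))
    (D : (Fin K → ℝ) → (Fin K → ℝ) → Prop)
    (hD : ∀ ℓ t, D ℓ t ↔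
      ((∑ k, t k) ≤ T ∧ (∀ k, 0 ≤ t k) ∧
       (∀ k, mplus k ≤ ℓ k ∧ ℓ k ≤ R k) ∧ (∀ k, 0 < ℓ k → 0 < t k)))
    (O1 O2 : Finset (Fin K))
    (hO1 : ∀ k, k ∈ O1 ↔ 0 < φ k) (hO2 : ∀ k, k ∈ O2 ↔ φ k = 0)
    (hO1ne : O1.Nonempty)
    (lammin : ℝ) (hlammin : lammin = O1.inf' hO1ne φ)
    (r : Fin K → ℝ)
    (hr : ∀ k, 0 < r k ∧ g (r k) = -((h k) ^ 2) * lammin / β k)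
    (hTlong : (∑ k ∈ O1, R k / r k) + (∑ k ∈ O2, mplus k / r k) ≤ T) :
    ∃ ℓs ts : Fin K → ℝ, D ℓs ts ∧ (∀ ℓ t, D ℓ t → E ℓs ts ≤ E ℓ t) ∧
      ∀ k ∈ O1, ℓs k = R k := by
  have hlog2 : 0 < Real.log 2 := Real.log_pos one_lt_two
  obtain ⟨c, hcdef⟩ : ∃ c, c = B / Real.log 2 := ⟨_, rfl⟩
  have hc : 0 < c := by rw [hcdef]; positivity
  have hpow : ∀ x : ℝ, (2 : ℝ) ^ (x / B) = Real.exp (x / c) := fun x => by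
    rw [Real.rpow_def_of_pos two_pos, hcdef]
    congr 1
    field_simp
  have hfexp : ∀ x, f x = N0 * (Real.exp (x / c) - 1) := fun x => by rw [hf, hpow]
  have hgred : ∀ x, g x = -(N0 * reducedPower (x / c)) := fun x => by
    have hlc : Real.log 2 / B = 1 / c := by rw [hcdef]; field_simp
    rw [hg, hfexp, hpow, reducedPower, mul_div_assoc, hlc]
    ring
  have hveq : ∀ k, v k * N0 = c * C k * P k * h k ^ 2 := fun k => by
    rw [hv, hcdef]
    field_simp
  have hvpos : ∀ k, 0 < v k := fun k => by
    have h1 := hC k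
    have h2 := hP k
    have h3 := hh k
    rw [hv]
    positivity
  have hw : ∀ k, 0 < β k * N0 / h k ^ 2 := fun k =>
    div_pos (mul_pos (hβ k) hN0) (pow_pos (hh k) 2)
  have hφred : ∀ k, 1 ≤ v k → φ k = β k * N0 / h k ^ 2 * reducedPower (Real.log (v k)) :=
    fun k hk => by
      rw [hφ, if_pos hk, reducedPower, Real.exp_log (hvpos k)]
      ring
  have hφnonneg : ∀ k, 0 ≤ φ k := fun k => by
    by_cases hk : 1 ≤ v k
    · rw [hφred k hk]
      exact mul_nonneg (hw k).le (reducedPower_nonneg (Real.log_nonneg hk))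
    · rw [hφ, if_neg hk]
  have hv_le : ∀ k, φ k = 0 → v k ≤ 1 := fun k hk => by
    by_contra! hlt
    have hlog := Real.log_pos hlt
    have hred := strictMonoOn_reducedPower Set.self_mem_Ici hlog.le hlog
    rw [reducedPower_zero] at hred
    have := mul_pos (hw k) hred
    rw [← hφred k hlt.le] at this
    exact this.ne' hk
  have hlamle : ∀ k ∈ O1, lammin ≤ φ k := fun k hk => by
    rw [hlammin]
    exact Finset.inf'_le _ hk
  have hlampos : 0 < lammin := by
    rw [hlammin, Finset.lt_inf'_iff]
    exact fun k hk => (hO1 k).mp hk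
  have hmem2 : ∀ k, k ∈ O2 ↔ k ∉ O1 := fun k => by
    rw [hO1, hO2]
    exact ⟨fun h0 => h0.not_gt, fun h0 => le_antisymm (not_lt.mp h0) (hφnonneg k)⟩
  have hm0 : ∀ k, 0 ≤ mplus k := fun k => by rw [hm]; exact le_max_right _ _
  have hmR : ∀ k, mplus k ≤ R k := fun k => by
    rw [hm]
    refine max_le ?_ (hR k)
    have := div_nonneg (mul_nonneg (hFloc k) hT.le) (hC k).le
    linarith
  obtain ⟨ℓs, hℓs⟩ : ∃ ℓs : Fin K → ℝ, ℓs = fun k => if k ∈ O1 then R k else mplus k := ⟨_, rfl⟩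
  have hℓs1 : ∀ k ∈ O1, ℓs k = R k := fun k hk => by rw [hℓs]; exact if_pos hk
  have hℓs2 : ∀ k, k ∉ O1 → ℓs k = mplus k := fun k hk => by rw [hℓs]; exact if_neg hk
  have hℓs0 : ∀ k, 0 ≤ ℓs k := fun k => by
    by_cases hk : k ∈ O1
    · rw [hℓs1 k hk]; exact hR k
    · rw [hℓs2 k hk]; exact hm0 k
  have hcompl : O2 = O1ᶜ := by
    ext k
    rw [hmem2, Finset.mem_compl]
  have hfit : ∑ k, ℓs k / (c * (r k / c)) ≤ T := by
    refine le_of_eq_of_le ?_ hTlong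
    rw [hcompl, ← Finset.sum_add_sum_compl O1]
    congr 1
    · refine Finset.sum_congr rfl fun k hk => ?_
      rw [hℓs1 k hk, mul_div_cancel₀ _ hc.ne']
    · refine Finset.sum_congr rfl fun k hk => ?_
      rw [hℓs2 k (Finset.mem_compl.mp hk), mul_div_cancel₀ _ hc.ne']
  have hrlam : ∀ k, reducedPower (r k / c) = h k ^ 2 / (β k * N0) * lammin := fun k => by
    have hgr := (hr k).2
    rw [hgred] at hgr
    have h1 := (hβ k).ne'
    field_simp at hgr ⊢
    linarith
  obtain ⟨lam, u, ts, hlam0, hlam_le, hu0, hulam, hts0, htsT, hslack, htsℓ⟩ :=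
    exists_priority_level (a := fun k => h k ^ 2 / (β k * N0)) hc hT hlampos
      (fun k => div_pos (pow_pos (hh k) 2) (mul_pos (hβ k) hN0)) hℓs0
      (fun k => (div_pos (hr k).1 hc).le) hrlam hfit
  have hupper : ∀ k ∈ O1, Real.exp (u k) ≤ v k := fun k hk => by
    have hφk := (hO1 k).mp hk
    have hvk : 1 ≤ v k := by
      by_contra hlt
      rw [hφ, if_neg hlt] at hφk
      exact lt_irrefl _ hφk
    rw [← Real.le_log_iff_exp_le (hvpos k)]
    rw [← strictMonoOn_reducedPower.le_iff_le (hu0 k) (Real.log_nonneg hvk), hulam]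
    have hle := hlam_le.trans (hlamle k hk)
    rw [hφred k hvk] at hle
    have h1 := hβ k
    have h2 := hh k
    calc h k ^ 2 / (β k * N0) * lam
        ≤ h k ^ 2 / (β k * N0) * (β k * N0 / h k ^ 2 * reducedPower (Real.log (v k))) := by gcongr
      _ = reducedPower (Real.log (v k)) := by field_simp
  have hlower : ∀ k, k ∉ O1 → v k ≤ Real.exp (u k) := fun k hk =>
    (hv_le k ((hO2 k).mp ((hmem2 k).mpr hk))).trans (Real.one_le_exp (hu0 k))
  have hsplit : ∀ k ℓ t, β k * (t / h k ^ 2 * f (ℓ / t) + (R k - ℓ) * C k * P k) =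
      β k * N0 / h k ^ 2 * (t * (Real.exp (ℓ / t / c) - 1) - v k * (ℓ / c)) +
        β k * R k * C k * P k := fun k ℓ t => by
    have h1 := (hh k).ne'
    have h2 : C k * P k = v k * N0 / (c * h k ^ 2) := by
      rw [hveq]
      field_simp
    rw [hfexp, mul_assoc (R k - ℓ), mul_assoc (β k * R k), h2]
    field_simp
    ring
  refine ⟨ℓs, ts, (hD _ _).mpr ⟨htsT, hts0, fun k => ?_, fun k hk => ?_⟩, ?_, hℓs1⟩
  · by_cases hk : k ∈ O1
    · rw [hℓs1 k hk]
      exact ⟨hmR k, le_rfl⟩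
    · rw [hℓs2 k hk]
      exact ⟨le_rfl, hmR k⟩
  · refine lt_of_le_of_ne (hts0 k) fun h0 => ?_
    rw [← htsℓ k, ← h0, zero_mul] at hk
    exact lt_irrefl _ hk
  intro ℓ t hℓt
  obtain ⟨htT, ht0, hℓ, hpos⟩ := (hD _ _).mp hℓt
  have hterm : ∀ k, β k * (ts k / h k ^ 2 * f (ℓs k / ts k) + (R k - ℓs k) * C k * P k)
      + lam * ts k ≤
      β k * (t k / h k ^ 2 * f (ℓ k / t k) + (R k - ℓ k) * C k * P k) + lam * t k := fun k => by
    have hlamu : β k * N0 / h k ^ 2 * reducedPower (u k) = lam := by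
      have h1 := (hβ k).ne'
      have h2 := (hh k).ne'
      rw [hulam]
      field_simp
    have htan := tangent_le_perspective (c := c) (u := u k) ((hm0 k).trans (hℓ k).1) (ht0 k) (hpos k)
    have hgain : 0 ≤ (Real.exp (u k) - v k) * ((ℓ k - ℓs k) / c) := by
      by_cases hk : k ∈ O1
      · rw [hℓs1 k hk]
        exact mul_nonneg_of_nonpos_of_nonpos (sub_nonpos.mpr (hupper k hk))
          (div_nonpos_of_nonpos_of_nonneg (sub_nonpos.mpr (hℓ k).2) hc.le)
      · rw [hℓs2 k hk]
        exact mul_nonneg (sub_nonneg.mpr (hlower k hk))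
          (div_nonneg (sub_nonneg.mpr (hℓ k).1) hc.le)
    rw [hsplit, hsplit, tangent_eq_perspective hc (htsℓ k)]
    have hsum : 0 ≤ β k * N0 / h k ^ 2 * (t k * (Real.exp (ℓ k / t k / c) - 1)
        - (Real.exp (u k) * (ℓ k / c) - reducedPower (u k) * t k)
        + (Real.exp (u k) - v k) * ((ℓ k - ℓs k) / c)) :=
      mul_nonneg (hw k).le (add_nonneg (sub_nonneg.mpr htan) hgain)
    rw [sub_div] at hsum
    linear_combination hsum + (t k - ts k) * hlamu
  have hall := Finset.sum_le_sum fun k (_ : k ∈ Finset.univ) => hterm k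
  simp only [Finset.sum_add_distrib (g := fun k => lam * ts k),
    Finset.sum_add_distrib (g := fun k => lam * t k), ← Finset.mul_sum] at hall
  rw [hE, hE]
  linarith [mul_le_mul_of_nonneg_left htT hlam0]
end

section
/- Fix an integer K ≥ 1 and, for each k ∈ {1,…,K}, reals C_k > 0, T > 0, F' > 0, F_k ≥ 0, R_k ≥ 0. Let m_k⁺ = max(R_k − F_k·T/C_k, 0). Then there exists (ℓ, t) ∈ ℝ^K × ℝ^K with t_k > 0 for all k, m_k⁺ ≤ ℓ_k ≤ R_k for all k, and (Σ_{k=1}^K C_k·ℓ_k)/F' + Σ_{k=1}^K t_k ≤ T, if and only if (Σ_{k=1}^K C_k·m_k⁺)/F' < T. -/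
/-- Feasibility condition for Problem P3 (finite-capacity cloud with
non-negligible computing time): a feasible point with strictly positive
transmission durations exists iff `(Σ_k C_k·m_k⁺)/F' < T`. -/
theorem problemP3_feasibility (K : ℕ) (hK : 1 ≤ K) (T F' : ℝ)
    (hT : 0 < T) (hF' : 0 < F')
    (C Floc R : Fin K → ℝ)
    (hC : ∀ k, 0 < C k) (hFloc : ∀ k, 0 ≤ Floc k) (hR : ∀ k, 0 ≤ R k)
    (mplus : Fin K → ℝ)
    (hm : ∀ k, mplus k = max (R k - Floc k * T / C k) 0) :
    (∃ ℓ t : Fin K → ℝ,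
        (∀ k, 0 < t k) ∧
        (∀ k, mplus k ≤ ℓ k ∧ ℓ k ≤ R k) ∧
        (∑ k, C k * ℓ k) / F' + (∑ k, t k) ≤ T) ↔
      (∑ k, C k * mplus k) / F' < T := by
  have hK0 : (0 : ℝ) < K := by exact_mod_cast hK
  constructor
  · rintro ⟨ℓ, t, ht, hℓ, h⟩
    have hne : (Finset.univ : Finset (Fin K)).Nonempty := ⟨⟨0, hK⟩, Finset.mem_univ _⟩
    have ht_sum : 0 < ∑ k, t k := Finset.sum_pos (fun k _ => ht k) hne
    have hle : (∑ k, C k * mplus k) / F' ≤ (∑ k, C k * ℓ k) / F' :=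
      div_le_div_of_nonneg_right
        (Finset.sum_le_sum fun k _ => mul_le_mul_of_nonneg_left (hℓ k).1 (hC k).le) hF'.le
    linarith
  · intro h
    refine ⟨mplus, fun _ => (T - (∑ k, C k * mplus k) / F') / K,
      fun _ => div_pos (sub_pos.2 h) hK0, fun k => ⟨le_rfl, ?_⟩, ?_⟩
    · have hlocal : 0 ≤ Floc k * T / C k := div_nonneg (mul_nonneg (hFloc k) hT.le) (hC k).le
      rw [hm k]
      exact max_le (by linarith) (hR k)
    · rw [Finset.sum_const, Finset.card_univ, Fintype.card_fin, nsmul_eq_mul,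
        mul_div_cancel₀ _ hK0.ne']
      linarith
end

section
/- Let B, N0, β, C, P, h, F' > 0, and set a = F'·ln 2/(B·C) and b = F'·P·h²/N0. Suppose z > 0 satisfies z·ln z + (a − 1)·z = b − 1, and define x = (β·N0/h²)·(z·ln z − z + 1) and X = (B/ln 2)·ln z. Then, with f(x) = N0·(2^{x/B} − 1), f'(x) = (N0·ln 2/B)·2^{x/B}, and g(x) = f(x) − x·f'(x), one has f'(X) = C·P·h² − x·C·h²/(β·F') and g(X) = −h²·x/β. In other words, x is a root of the equation f'^{-1}(C·P·h² − x·C·h²/(β·F')) = g^{-1}(−h²·x/β). -/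
/-- Lemma 6: for the finite-capacity cloud with non-negligible computing time,
with `a = F'·ln 2/(B·C)`, `b = F'·P·h²/N0`, and `z > 0` solving
`z·ln z + (a−1)·z = b−1`, the priority `x = (β·N0/h²)·(z·ln z − z + 1)` is a
root of `f'^{-1}(C·P·h² − x·C·h²/(β·F')) = g^{-1}(−h²·x/β)`: the point
`X = (B/ln 2)·ln z` satisfies `f'(X) = C·P·h² − x·C·h²/(β·F')` and
`g(X) = −h²·x/β`. -/
theorem offloading_priority_root_nonnegligible_time (B N0 β C P h F' : ℝ)
    (hB : 0 < B) (hN0 : 0 < N0) (hβ : 0 < β) (hC : 0 < C) (hP : 0 < P)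
    (hh : 0 < h) (hF' : 0 < F')
    (a b : ℝ) (ha : a = F' * Real.log 2 / (B * C)) (hb : b = F' * P * h ^ 2 / N0)
    (z : ℝ) (hz : 0 < z) (hzeq : z * Real.log z + (a - 1) * z = b - 1)
    (x : ℝ) (hx : x = (β * N0 / h ^ 2) * (z * Real.log z - z + 1))
    (X : ℝ) (hX : X = (B / Real.log 2) * Real.log z)
    (f f' g : ℝ → ℝ)
    (hf : ∀ y, f y = N0 * ((2 : ℝ) ^ (y / B) - 1))
    (hf' : ∀ y, f' y = N0 * Real.log 2 / B * (2 : ℝ) ^ (y / B))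
    (hg : ∀ y, g y = f y - y * f' y) :
    f' X = C * P * h ^ 2 - x * C * h ^ 2 / (β * F') ∧ g X = -(h ^ 2) * x / β := by
  have hlog : Real.log 2 ≠ 0 := (Real.log_pos one_lt_two).ne'
  have hpow : (2 : ℝ) ^ (X / B) = z := by
    rw [Real.rpow_def_of_pos two_pos, hX,
      show Real.log 2 * (B / Real.log 2 * Real.log z / B) = Real.log z by field_simp,
      Real.exp_log hz]
  constructor
  · have hkey : z * Real.log z - z + 1 = b - a * z := by linarith
    rw [hf', hpow, hx, hkey, ha, hb]
    field_simp
    ring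
  · rw [hg, hf, hf', hpow, hX, hx]
    field_simp
    ring
end

section
/- Let a > 0 and b > 1 be reals. Then there exists a unique z > 0 satisfying z·ln z + (a − 1)·z = b − 1, and this unique root satisfies z > 1 if and only if b > a. -/
/-- Where `z ↦ z * log z + k * z` is positive, it is strictly increasing. -/
theorem mul_log_add_mul_lt_of_pos {k z w : ℝ} (hz : 0 < z) (hzw : z < w)
    (hpos : 0 < z * Real.log z + k * z) :
    z * Real.log z + k * z < w * Real.log w + k * w := by
  have hfac : 0 < Real.log z + k :=
    pos_of_mul_pos_right (by linarith : 0 < z * (Real.log z + k)) hz.le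
  have hlog : Real.log z < Real.log w := Real.log_lt_log hz hzw
  have hmul : z * (Real.log z + k) < w * (Real.log w + k) := by
    apply mul_lt_mul'' hzw _ hz.le hfac.le
    linarith
  linarith

/-- The function `z ↦ z * log z + k * z` attains every nonnegative value at a positive point. -/
theorem exists_pos_mul_log_add_mul_eq (k : ℝ) {c : ℝ} (hc : 0 ≤ c) :
    ∃ z : ℝ, 0 < z ∧ z * Real.log z + k * z = c := by
  have ht : 0 ≤ c * Real.exp k := by positivity
  have hle : Real.exp (-k) ≤ Real.exp (-k + c * Real.exp k) :=
    Real.exp_le_exp.mpr (by linarith)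
  have hcont : Continuous fun z : ℝ => z * Real.log z + k * z :=
    Real.continuous_mul_log.add (continuous_const.mul continuous_id)
  have hupper : c ≤ Real.exp (-k + c * Real.exp k) * (c * Real.exp k) := by
    have heq : Real.exp (-k + c * Real.exp k) * (c * Real.exp k)
        = c * Real.exp (c * Real.exp k) := by
      rw [Real.exp_add, Real.exp_neg]
      field_simp
    rw [heq]
    exact le_mul_of_one_le_right hc (Real.one_le_exp ht)
  obtain ⟨z, hz, hzc⟩ := intermediate_value_Icc hle hcont.continuousOn
    (show c ∈ Set.Icc _ _ from
      ⟨by simp only [Real.log_exp]; linarith, by simp only [Real.log_exp]; linarith⟩)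
  exact ⟨z, (Real.exp_pos _).trans_le hz.1, hzc⟩

/-- Lemma 7: for `a > 0` and `b > 1` there is a unique `z > 0` with
`z·ln z + (a − 1)·z = b − 1`, and this root satisfies `z > 1` iff `b > a`. -/
theorem unique_root_and_comparison (a b : ℝ) (ha : 0 < a) (hb : 1 < b) :
    (∃! z : ℝ, 0 < z ∧ z * Real.log z + (a - 1) * z = b - 1) ∧
    (∀ z : ℝ, 0 < z → z * Real.log z + (a - 1) * z = b - 1 → (1 < z ↔ a < b)) := by
  have hc : 0 < b - 1 := by linarith
  refine ⟨?_, fun z hz hzb => ⟨fun h1 => ?_, fun hab => ?_⟩⟩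
  · obtain ⟨z, hz, hzb⟩ := exists_pos_mul_log_add_mul_eq (a - 1) hc.le
    refine ⟨z, ⟨hz, hzb⟩, fun w ⟨hw, hwb⟩ => ?_⟩
    rcases lt_trichotomy w z with h | h | h
    · linarith [mul_log_add_mul_lt_of_pos hw h (hwb ▸ hc)]
    · exact h
    · linarith [mul_log_add_mul_lt_of_pos hz h (hzb ▸ hc)]
  · by_contra! hba
    have h := mul_log_add_mul_lt_of_pos (k := a - 1) one_pos h1 (by simp; linarith)
    simp only [Real.log_one] at h
    linarith
  · by_contra! hz1
    rcases hz1.lt_or_eq with h | rfl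
    · have h' := mul_log_add_mul_lt_of_pos hz h (hzb ▸ hc)
      simp only [Real.log_one] at h'
      linarith
    · simp only [Real.log_one] at hzb
      linarith
end

section
/- Let B > 0 and N0 > 0, and define g(x) = N0·(2^{x/B} − 1) − x·(N0·ln 2/B)·2^{x/B}. For any reals y and w, if w·e^w = −(y + N0)/(N0·e), then g(B·(w + 1)/ln 2) = y. -/
/-- Lemma 9: the inverse of `g(x) = N0·(2^{x/B} − 1) − x·(N0·ln 2/B)·2^{x/B}`
is `g^{-1}(y) = B·(W₀(−(y + N0)/(N0·e)) + 1)/ln 2`: if `w·e^w = −(y + N0)/(N0·e)`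
then `g(B·(w + 1)/ln 2) = y`. -/
theorem g_inverse_lambert (B N0 : ℝ) (hB : 0 < B) (hN0 : 0 < N0)
    (g : ℝ → ℝ)
    (hg : ∀ x, g x = N0 * ((2 : ℝ) ^ (x / B) - 1) -
      x * (N0 * Real.log 2 / B * (2 : ℝ) ^ (x / B)))
    (y w : ℝ) (hwe : w * Real.exp w = -(y + N0) / (N0 * Real.exp 1)) :
    g (B * (w + 1) / Real.log 2) = y := by
  have hlog : Real.log 2 ≠ 0 := (Real.log_pos one_lt_two).ne'
  have hpow : (2 : ℝ) ^ (B * (w + 1) / Real.log 2 / B) = Real.exp w * Real.exp 1 := by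
    rw [Real.rpow_def_of_pos two_pos, ← Real.exp_add]
    congr 1
    field_simp
  have hmul : w * Real.exp w * (N0 * Real.exp 1) = -(y + N0) :=
    (eq_div_iff (mul_pos hN0 (Real.exp_pos 1)).ne').mp hwe
  have hcoef : B * (w + 1) / Real.log 2 *
      (N0 * Real.log 2 / B * (Real.exp w * Real.exp 1)) =
      (w + 1) * N0 * (Real.exp w * Real.exp 1) := by
    field_simp
  rw [hg, hpow, hcoef]
  linear_combination -hmul
end

section
/- Let B > 0 and N0 > 0, and define g(x) = N0·(2^{x/B} − 1) − x·(N0·ln 2/B)·2^{x/B}. Then g is strictly decreasing on the interval [0, ∞); consequently, g restricted to [0, ∞) is injective with g(0) = 0 and g(x) < 0 for all x > 0, so its inverse is strictly decreasing on g([0,∞)) ⊆ (−∞, 0]. -/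
theorem strictAntiOn_one_sub_mul_exp :
    StrictAntiOn (fun t : ℝ => (1 - t) * Real.exp t) (Set.Ici 0) := by
  intro s hs t _ hst
  have hs : 0 ≤ s := hs
  have h₁ : s - t + 1 < Real.exp (s - t) := Real.add_one_lt_exp (by linarith)
  have h₂ : Real.exp (s - t) < 1 := by
    simpa using hst
  have h₃ : Real.exp s = Real.exp (s - t) * Real.exp t := by
    rw [← Real.exp_add, sub_add_cancel]
  change (1 - t) * Real.exp t < (1 - s) * Real.exp s
  rw [h₃, ← mul_assoc]
  refine mul_lt_mul_of_pos_right ?_ (Real.exp_pos t)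
  nlinarith [mul_nonneg hs (sub_nonneg.2 h₂.le)]

theorem StrictAntiOn.invFunOn_image {α β : Type*} [LinearOrder α] [Preorder β] [Nonempty α]
    {f : α → β} {s : Set α} (hf : StrictAntiOn f s) :
    StrictAntiOn (Function.invFunOn f s) (f '' s) := by
  rintro _ ⟨a, ha, rfl⟩ _ ⟨b, hb, rfl⟩ hab
  rw [hf.injOn.leftInvOn_invFunOn ha, hf.injOn.leftInvOn_invFunOn hb]
  exact (hf.lt_iff_gt ha hb).1 hab

/-- Lemma 10: `g(x) = N0·(2^{x/B} − 1) − x·(N0·ln 2/B)·2^{x/B}` is strictly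
decreasing on `[0, ∞)`; consequently it is injective there with `g(0) = 0` and
`g(x) < 0` for `x > 0`, so its inverse is strictly decreasing on
`g([0,∞)) ⊆ (−∞, 0]`. -/
theorem g_strictAnti_and_inverse (B N0 : ℝ) (hB : 0 < B) (hN0 : 0 < N0)
    (g : ℝ → ℝ)
    (hg : ∀ x, g x = N0 * ((2 : ℝ) ^ (x / B) - 1) -
      x * (N0 * Real.log 2 / B * (2 : ℝ) ^ (x / B))) :
    StrictAntiOn g (Set.Ici 0) ∧
    Set.InjOn g (Set.Ici 0) ∧
    g 0 = 0 ∧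
    (∀ x : ℝ, 0 < x → g x < 0) ∧
    g '' Set.Ici 0 ⊆ Set.Iic 0 ∧
    StrictAntiOn (Function.invFunOn g (Set.Ici 0)) (g '' Set.Ici (0 : ℝ)) := by
  have hlog : 0 < Real.log 2 / B := div_pos (Real.log_pos one_lt_two) hB
  have hform : ∀ x, g x =
      N0 * ((1 - Real.log 2 / B * x) * Real.exp (Real.log 2 / B * x) - 1) := by
    intro x
    rw [hg, Real.rpow_def_of_pos two_pos, ← mul_comm_div]
    ring
  have hanti : StrictAntiOn g (Set.Ici 0) := by
    intro x hx y hy hxy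
    have h := strictAntiOn_one_sub_mul_exp (mul_nonneg hlog.le hx) (mul_nonneg hlog.le hy)
      (mul_lt_mul_of_pos_left hxy hlog)
    rw [hform, hform]
    exact mul_lt_mul_of_pos_left (sub_lt_sub_right h 1) hN0
  have hzero : g 0 = 0 := by simp [hg]
  refine ⟨hanti, hanti.injOn, hzero, fun x hx => ?_, ?_, hanti.invFunOn_image⟩
  · exact hzero ▸ hanti Set.self_mem_Ici hx.le hx
  · rintro _ ⟨x, hx, rfl⟩
    exact hzero ▸ hanti.antitoneOn Set.self_mem_Ici hx hx
end

section
/- Let S be a nonempty finite index set, and let B̄, T, N̄0 > 0, L ≥ 0, ξ > 0 and h_n > 0 for each n ∈ S. Define ℓ*_n = max(0, B̄·T·log₂(ξ·B̄·T·h_n²/(N̄0·ln 2))) for n ∈ S, and suppose Σ_{n∈S} ℓ*_n = L. Then for every ℓ : S → ℝ with ℓ_n ≥ 0 for all n and Σ_{n∈S} ℓ_n = L, it holds that Σ_{n∈S} (N̄0/h_n²)·(2^{ℓ_n/(B̄·T)} − 1) ≥ Σ_{n∈S} (N̄0/h_n²)·(2^{ℓ*_n/(B̄·T)} − 1); i.e.,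 ℓ* minimizes the total offloading energy Σ_{n∈S} (1/h_n²)·f̄(ℓ_n), where f̄(x) = N̄0·(2^{x/(B̄·T)} − 1), subject to ℓ_n ≥ 0 and Σ_n ℓ_n = L. -/
/-- Tangent-line inequality for the exponential `t ↦ 2 ^ (t / c)`. -/
theorem two_rpow_div_tangent_le (c x y : ℝ) :
    (2 : ℝ) ^ (x / c) * (Real.log 2 / c * (y - x)) ≤ (2 : ℝ) ^ (y / c) - (2 : ℝ) ^ (x / c) := by
  have hsplit : (2 : ℝ) ^ (y / c) = (2 : ℝ) ^ (x / c) * Real.exp (Real.log 2 / c * (y - x)) := by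
    rw [Real.rpow_def_of_pos two_pos, Real.rpow_def_of_pos two_pos, ← Real.exp_add]
    congr 1
    ring
  have hexp := Real.add_one_le_exp (Real.log 2 / c * (y - x))
  have hpos : (0 : ℝ) < (2 : ℝ) ^ (x / c) := Real.rpow_pos_of_pos two_pos _
  rw [hsplit]
  nlinarith

/-- At the water-filling level, `ξ` is a subgradient on `[0, ∞)` of the weighted exponential
energy `t ↦ w * (2 ^ (t / c) - 1)`. -/
theorem waterfilling_subgradient {c w ξ x y : ℝ} (hc : 0 < c) (hw : 0 < w) (hξ : 0 < ξ)
    (hx : x = max 0 (c * Real.logb 2 (ξ * c / (w * Real.log 2)))) (hy : 0 ≤ y) :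
    w * ((2 : ℝ) ^ (x / c) - 1) + ξ * (y - x) ≤ w * ((2 : ℝ) ^ (y / c) - 1) := by
  have hlog : 0 < Real.log 2 := Real.log_pos one_lt_two
  have ha : 0 < ξ * c / (w * Real.log 2) := by positivity
  have htan := mul_le_mul_of_nonneg_left (two_rpow_div_tangent_le c x y) hw.le
  suffices hslope : ξ * (y - x) ≤ w * ((2 : ℝ) ^ (x / c) * (Real.log 2 / c * (y - x))) by
    linarith
  rcases le_total 1 (ξ * c / (w * Real.log 2)) with h1 | h1
  · have hpow : (2 : ℝ) ^ (x / c) = ξ * c / (w * Real.log 2) := by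
      rw [hx, max_eq_right (mul_nonneg hc.le (Real.logb_nonneg one_lt_two h1)),
        mul_div_cancel_left₀ _ hc.ne', Real.rpow_logb two_pos (by norm_num) ha]
    rw [hpow]
    apply le_of_eq
    field_simp
  · have hx0 : x = 0 := by
      rw [hx, max_eq_left (mul_nonpos_of_nonneg_of_nonpos hc.le
        (Real.logb_nonpos one_lt_two ha.le h1))]
    have hle : ξ ≤ w * Real.log 2 / c := by
      rw [le_div_iff₀ hc]
      simpa using (div_le_iff₀ (by positivity)).1 h1
    calc ξ * (y - x) ≤ w * Real.log 2 / c * (y - x) :=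
          mul_le_mul_of_nonneg_right hle (by simpa [hx0] using hy)
      _ = w * ((2 : ℝ) ^ (x / c) * (Real.log 2 / c * (y - x))) := by
          rw [hx0, zero_div, Real.rpow_zero]
          ring

/-- Proposition 3 (Problem P6): the water-filling allocation
`ℓ*_n = [B̄·T·log₂(ξ·B̄·T·h_n²/(N̄0·ln 2))]⁺` with `Σ_{n∈S} ℓ*_n = L` minimizes
the total offloading energy `Σ_{n∈S} (N̄0/h_n²)·(2^{ℓ_n/(B̄·T)} − 1)` among all
nonnegative allocations summing to `L`. -/
theorem waterfilling_optimal_data_allocation {ι : Type*} (S : Finset ι)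
    (hS : S.Nonempty) (Bbar T N0bar L ξ : ℝ)
    (hB : 0 < Bbar) (hT : 0 < T) (hN0 : 0 < N0bar) (hL : 0 ≤ L) (hξ : 0 < ξ)
    (h : ι → ℝ) (hh : ∀ n ∈ S, 0 < h n)
    (ℓstar : ι → ℝ)
    (hℓstar : ∀ n, ℓstar n =
      max 0 (Bbar * T * Real.logb 2 (ξ * Bbar * T * (h n) ^ 2 / (N0bar * Real.log 2))))
    (hsum : ∑ n ∈ S, ℓstar n = L) :
    ∀ ℓ : ι → ℝ, (∀ n ∈ S, 0 ≤ ℓ n) → (∑ n ∈ S, ℓ n = L) →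
      ∑ n ∈ S, (N0bar / (h n) ^ 2) * ((2 : ℝ) ^ (ℓstar n / (Bbar * T)) - 1) ≤
      ∑ n ∈ S, (N0bar / (h n) ^ 2) * ((2 : ℝ) ^ (ℓ n / (Bbar * T)) - 1) := by
  intro ℓ hℓ hℓsum
  have hterm : ∀ n ∈ S,
      (N0bar / (h n) ^ 2) * ((2 : ℝ) ^ (ℓstar n / (Bbar * T)) - 1) + ξ * (ℓ n - ℓstar n) ≤
        (N0bar / (h n) ^ 2) * ((2 : ℝ) ^ (ℓ n / (Bbar * T)) - 1) := by
    intro n hn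
    have hpos := hh n hn
    refine waterfilling_subgradient (mul_pos hB hT) (by positivity) hξ ?_ (hℓ n hn)
    have hlog : 0 < Real.log 2 := Real.log_pos one_lt_two
    have harg : ξ * Bbar * T * (h n) ^ 2 / (N0bar * Real.log 2) =
        ξ * (Bbar * T) / (N0bar / (h n) ^ 2 * Real.log 2) := by
      field_simp
    rw [hℓstar n, harg]
  have htotal := Finset.sum_le_sum hterm
  rwa [Finset.sum_add_distrib, ← Finset.mul_sum, Finset.sum_sub_distrib, hℓsum, hsum, sub_self,
    mul_zero, add_zero] at htotal
end
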